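/- Let N be a tree-based rooted binary phylogenetic X-network with maximal zig-zag trail decomposition Z_1, …, Z_d. Then the number of support trees of N equals the product over i ∈ {1,…,d} of c_i, where c_i = 2 if Z_i is a crown, c_i = |A(Z_i)|/2 if Z_i is an M-fence, and c_i = 1 if Z_i is an N-fence. -/

import Mathlib

/-- A finite simple directed graph, given by a finite vertex set and a finite
set of arcs (ordered pairs of vertices) whose endpoints lie in the vertex set. -/
structure Dgraph (V : Type*) where
  verts : Finset V
  arcs : Finset (V × V)
  tail_mem : ∀ a ∈ arcs, a.1 ∈ verts
  head_mem : ∀ a ∈ arcs, a.2 ∈ verts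

namespace Dgraph

variable {V : Type*}

/-- The in-degree of a vertex. -/
def indeg [DecidableEq V] (G : Dgraph V) (v : V) : ℕ :=
  (G.arcs.filter fun a => a.2 = v).card

/-- The out-degree of a vertex. -/
def outdeg [DecidableEq V] (G : Dgraph V) (v : V) : ℕ :=
  (G.arcs.filter fun a => a.1 = v).card

/-- A leaf is a vertex of in-degree 1 and out-degree 0. -/
def IsLeaf [DecidableEq V] (G : Dgraph V) (v : V) : Prop :=
  v ∈ G.verts ∧ G.indeg v = 1 ∧ G.outdeg v = 0

/-- A directed graph is acyclic if it has no directed cycle. -/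
def Acyclic (G : Dgraph V) : Prop :=
  ∀ v : V, ¬ Relation.TransGen (fun u w => (u, w) ∈ G.arcs) v v

def IsSubgraph (H G : Dgraph V) : Prop :=
  H.verts ⊆ G.verts ∧ H.arcs ⊆ G.arcs

/-- The subgraph induced by a set of arcs: its vertices are all endpoints of those arcs. -/
def ofArcs [DecidableEq V] (A : Finset (V × V)) : Dgraph V where
  verts := A.image Prod.fst ∪ A.image Prod.snd
  arcs := A
  tail_mem := fun a ha => Finset.mem_union_left _ (Finset.mem_image_of_mem _ ha)
  head_mem := fun a ha => Finset.mem_union_right _ (Finset.mem_image_of_mem _ ha)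

/-- A rooted binary phylogenetic `X`-network: a finite simple directed acyclic graph
with a unique root of in-degree 0 and out-degree 1 or 2, whose leaf set is the
nonempty finite set `X`, and all of whose other vertices have
`{in-degree, out-degree} = {1, 2}`. -/
def IsRBPN [DecidableEq V] (N : Dgraph V) (X : Finset V) : Prop :=
  N.Acyclic ∧ X.Nonempty ∧ X ⊆ N.verts ∧
  ∃ ρ ∈ N.verts,
    N.indeg ρ = 0 ∧ (N.outdeg ρ = 1 ∨ N.outdeg ρ = 2) ∧
    (∀ v ∈ N.verts, N.indeg v = 0 → v = ρ) ∧
    (∀ v ∈ N.verts, (N.IsLeaf v ↔ v ∈ X)) ∧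
    (∀ v ∈ N.verts, v ∉ X → v ≠ ρ →
      (N.indeg v = 1 ∧ N.outdeg v = 2) ∨ (N.indeg v = 2 ∧ N.outdeg v = 1))

/-- A rooted binary phylogenetic `X`-tree: a rooted binary phylogenetic `X`-network
with no vertex of in-degree 2. -/
def IsRBPT [DecidableEq V] (T : Dgraph V) (X : Finset V) : Prop :=
  IsRBPN T X ∧ ∀ v ∈ T.verts, T.indeg v ≠ 2

/-- `H` is obtained from `G` by inserting one new (subdividing) vertex into one arc. -/
def SubdivideArc [DecidableEq V] (G H : Dgraph V) : Prop :=
  ∃ u v w : V, (u, v) ∈ G.arcs ∧ w ∉ G.verts ∧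
    H.verts = insert w G.verts ∧
    H.arcs = insert (u, w) (insert (w, v) (G.arcs.erase (u, v)))

/-- `IsSubdivisionOf T τ` : `τ` is obtained from `T` by inserting zero or more
subdividing vertices into arcs. -/
inductive IsSubdivisionOf [DecidableEq V] : Dgraph V → Dgraph V → Prop
  | refl (G : Dgraph V) : IsSubdivisionOf G G
  | step {G H K : Dgraph V} : IsSubdivisionOf G H → SubdivideArc H K → IsSubdivisionOf G K

/-- A support tree of `N`: a spanning subgraph of `N` that can be obtained from some
rooted binary phylogenetic `X`-tree by inserting zero or more vertices into each arc. -/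
def IsSupportTree [DecidableEq V] (N : Dgraph V) (X : Finset V) (τ : Dgraph V) : Prop :=
  τ.verts = N.verts ∧ τ.arcs ⊆ N.arcs ∧
  ∃ T : Dgraph V, IsRBPT T X ∧ IsSubdivisionOf T τ

/-- `N` is tree-based if it has a support tree. -/
def IsTreeBased [DecidableEq V] (N : Dgraph V) (X : Finset V) : Prop :=
  ∃ τ : Dgraph V, IsSupportTree N X τ

/-- `S` is an admissible arc-set of `G`. -/
def IsAdmissible [DecidableEq V] (G : Dgraph V) (S : Finset (V × V)) : Prop :=
  S ⊆ G.arcs ∧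
  (∀ a ∈ G.arcs, (G.indeg a.2 = 1 ∨ G.outdeg a.1 = 1) → a ∈ S) ∧
  (∀ a₁ ∈ G.arcs, ∀ a₂ ∈ G.arcs, a₁ ≠ a₂ → a₁.2 = a₂.2 →
    ((a₁ ∈ S ∧ a₂ ∉ S) ∨ (a₁ ∉ S ∧ a₂ ∈ S))) ∧
  (∀ a₁ ∈ G.arcs, ∀ a₂ ∈ G.arcs, a₁ ≠ a₂ → a₁.1 = a₂.1 → (a₁ ∈ S ∨ a₂ ∈ S))

end Dgraph

namespace Dgraph

variable {V : Type*}

/-- `Z` is (the arc set of) a zig-zag trail in `N`: a nonempty set of arcs of `N`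
admitting an ordering in which any two consecutive arcs share a head or share a tail
(the corresponding subgraph is the one induced by these arcs). -/
def IsZigzag [DecidableEq V] (N : Dgraph V) (Z : Finset (V × V)) : Prop :=
  Z ⊆ N.arcs ∧ ∃ l : List (V × V), l ≠ [] ∧ l.Nodup ∧ l.toFinset = Z ∧
    l.Chain' fun a b => a.2 = b.2 ∨ a.1 = b.1

/-- A maximal zig-zag trail of `N`: one that is not a proper subgraph of another
zig-zag trail in `N`. -/
def IsMaxZigzag [DecidableEq V] (N : Dgraph V) (Z : Finset (V × V)) : Prop :=
  IsZigzag N Z ∧ ∀ Z' : Finset (V × V), IsZigzag N Z' → Z ⊆ Z' → Z' = Z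

end Dgraph

namespace Dgraph

variable {V : Type*}

/-- The `k`-th arc (`k ≥ 1`) of a zig-zag written `v₀ < v₁ > v₂ < v₃ > ⋯`
(so `a₁ = (v₁, v₀)`, `a₂ = (v₁, v₂)`, `a₃ = (v₃, v₂)`, `a₄ = (v₃, v₄)`, …). -/
def mArc (v : ℕ → V) (k : ℕ) : V × V :=
  if k % 2 = 1 then (v k, v (k - 1)) else (v (k - 1), v k)

/-- The `k`-th arc (`k ≥ 1`) of a zig-zag written `v₀ > v₁ < v₂ > v₃ < ⋯`
(so `a₁ = (v₀, v₁)`, `a₂ = (v₂, v₁)`, `a₃ = (v₂, v₃)`, …). -/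
def nArc (v : ℕ → V) (k : ℕ) : V × V :=
  if k % 2 = 1 then (v (k - 1), v k) else (v k, v (k - 1))

/-- `Z` can be written cyclically as `v₀ < v₁ > v₂ < ⋯ > v_m = v₀` with `m` even,
`m ≥ 4` (a crown). -/
def CrownForm [DecidableEq V] (Z : Finset (V × V)) : Prop :=
  ∃ (m : ℕ) (v : ℕ → V), 4 ≤ m ∧ m % 2 = 0 ∧ v m = v 0 ∧ Z.card = m ∧
    Z = (Finset.Icc 1 m).image (mArc v)

/-- `Z` can be written as `v₀ < v₁ > v₂ < ⋯ < v_{m-1} > v_m` with `m` even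
(an M-fence). -/
def MFenceForm [DecidableEq V] (Z : Finset (V × V)) : Prop :=
  ∃ (m : ℕ) (v : ℕ → V), m % 2 = 0 ∧ Z.card = m ∧
    Z = (Finset.Icc 1 m).image (mArc v)

/-- `Z` can be written as `v₀ > v₁ < v₂ > ⋯ < v_{m-1} > v_m` with `m` odd
(an N-fence). -/
def NFenceForm [DecidableEq V] (Z : Finset (V × V)) : Prop :=
  ∃ (m : ℕ) (v : ℕ → V), m % 2 = 1 ∧ Z.card = m ∧
    Z = (Finset.Icc 1 m).image (nArc v)

end Dgraph

/-- The number `c_i` attached to a maximal zig-zag trail: `2` for a crown,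
`|A(Z)|/2` for an M-fence (even fence), and `1` for an N-fence (odd fence). -/
noncomputable def trailCount {V : Type*} [DecidableEq V] (Z : Finset (V × V)) : ℕ :=
  letI := Classical.propDecidable (Dgraph.CrownForm Z)
  if Dgraph.CrownForm Z then 2 else if Z.card % 2 = 0 then Z.card / 2 else 1

open Dgraph

def Adm8 {V : Type*} (A S : Finset (V × V)) : Prop :=
  S ⊆ A ∧ (∀ a ∈ A, (∀ b ∈ A, b.2 = a.2 → b = a) → a ∈ S) ∧
  (∀ a ∈ A, (∀ b ∈ A, b.1 = a.1 → b = a) → a ∈ S) ∧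
  (∀ a ∈ A, ∀ b ∈ A, a ≠ b → a.2 = b.2 → (a ∈ S ↔ b ∉ S)) ∧
  (∀ a ∈ A, ∀ b ∈ A, a ≠ b → a.1 = b.1 → (a ∈ S ∨ b ∈ S))

structure TL8 {V : Type*} (τ : Dgraph V) (X : Finset V) (ρ : V) : Prop where
  root_mem : ρ ∈ τ.verts
  root_X : ρ ∉ X
  root : ∀ u, (u, ρ) ∉ τ.arcs
  par : ∀ v ∈ τ.verts, v ≠ ρ → ∃ u, (u, v) ∈ τ.arcs
  paru : ∀ u u' v, (u, v) ∈ τ.arcs → (u', v) ∈ τ.arcs → u = u'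
  leaf : ∀ v ∈ τ.verts, (v ∈ X ↔ ∀ w, (v, w) ∉ τ.arcs)
  sub : X ⊆ τ.verts

section
variable {V : Type*} [DecidableEq V]

lemma indeg_zero8 (G : Dgraph V) (v : V) : G.indeg v = 0 ↔ ∀ u, (u, v) ∉ G.arcs := by
  unfold Dgraph.indeg
  rw [Finset.card_eq_zero, Finset.filter_eq_empty_iff]
  constructor
  · intro h u hu; exact h hu rfl
  · rintro h ⟨a, b⟩ hab rfl; exact h _ hab

lemma outdeg_zero8 (G : Dgraph V) (v : V) : G.outdeg v = 0 ↔ ∀ u, (v, u) ∉ G.arcs := by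
  unfold Dgraph.outdeg
  rw [Finset.card_eq_zero, Finset.filter_eq_empty_iff]
  constructor
  · intro h u hu; exact h hu rfl
  · rintro h ⟨a, b⟩ hab rfl; exact h _ hab

lemma indeg_le_one8 (G : Dgraph V) (v : V) :
    G.indeg v ≤ 1 ↔ ∀ u u', (u, v) ∈ G.arcs → (u', v) ∈ G.arcs → u = u' := by
  unfold Dgraph.indeg
  rw [Finset.card_le_one]
  simp only [Finset.mem_filter]
  constructor
  · intro h u u' hu hu'
    exact congrArg Prod.fst (h _ ⟨hu, rfl⟩ _ ⟨hu', rfl⟩)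
  · rintro h ⟨a, b⟩ ⟨hab, rfl⟩ ⟨c, d⟩ ⟨hcd, h2⟩
    simp only at h2 hcd hab ⊢
    subst h2
    rw [h _ _ hab hcd]

lemma outdeg_le_one8 (G : Dgraph V) (v : V) :
    G.outdeg v ≤ 1 ↔ ∀ u u', (v, u) ∈ G.arcs → (v, u') ∈ G.arcs → u = u' := by
  unfold Dgraph.outdeg
  rw [Finset.card_le_one]
  simp only [Finset.mem_filter]
  constructor
  · intro h u u' hu hu'
    exact congrArg Prod.snd (h _ ⟨hu, rfl⟩ _ ⟨hu', rfl⟩)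
  · rintro h ⟨a, b⟩ ⟨hab, rfl⟩ ⟨c, d⟩ ⟨hcd, h2⟩
    simp only at h2 hcd hab ⊢
    subst h2
    rw [h _ _ hab hcd]

lemma indeg_le_two8 (G : Dgraph V) (v : V) : G.indeg v ≤ 2 ↔
    ∀ a b c, (a, v) ∈ G.arcs → (b, v) ∈ G.arcs → (c, v) ∈ G.arcs → a = b ∨ a = c ∨ b = c := by
  unfold Dgraph.indeg
  rw [← not_lt, Finset.two_lt_card_iff]
  simp only [Finset.mem_filter]
  constructor
  · intro h a b c ha hb hc
    by_contra hh
    push Not at hh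
    refine h ⟨_, _, _, ⟨ha, rfl⟩, ⟨hb, rfl⟩, ⟨hc, rfl⟩, ?_, ?_, ?_⟩ <;> grind
  · rintro h ⟨⟨a, _⟩, ⟨b, _⟩, ⟨c, _⟩, ⟨ha, rfl⟩, ⟨hb, h1⟩, ⟨hc, h2⟩, h3, h4, h5⟩
    simp only at h1 h2
    subst h1; subst h2
    have := h a b c ha hb hc
    grind

lemma outdeg_le_two8 (G : Dgraph V) (v : V) : G.outdeg v ≤ 2 ↔
    ∀ a b c, (v, a) ∈ G.arcs → (v, b) ∈ G.arcs → (v, c) ∈ G.arcs → a = b ∨ a = c ∨ b = c := by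
  unfold Dgraph.outdeg
  rw [← not_lt, Finset.two_lt_card_iff]
  simp only [Finset.mem_filter]
  constructor
  · intro h a b c ha hb hc
    by_contra hh
    push Not at hh
    refine h ⟨_, _, _, ⟨ha, rfl⟩, ⟨hb, rfl⟩, ⟨hc, rfl⟩, ?_, ?_, ?_⟩ <;> grind
  · rintro h ⟨⟨_, a⟩, ⟨_, b⟩, ⟨_, c⟩, ⟨ha, rfl⟩, ⟨hb, h1⟩, ⟨hc, h2⟩, h3, h4, h5⟩
    simp only at h1 h2
    subst h1; subst h2
    have := h a b c ha hb hc
    grind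

lemma TL8_of_RBPT (T : Dgraph V) (X : Finset V) (h : IsRBPT T X) : ∃ ρ, TL8 T X ρ := by
  obtain ⟨⟨hac, hne, hsub, ρ, hρ, hin, hout, huniq, hleaf, hoth⟩, h2⟩ := h
  have hρX : ρ ∉ X := by
    intro hX
    have := ((hleaf ρ hρ).2 hX).2.1
    omega
  refine ⟨ρ, hρ, hρX, (indeg_zero8 _ _).1 hin, ?_, ?_, ?_, hsub⟩
  · intro v hv hvρ
    by_contra hcon
    push Not at hcon
    exact hvρ (huniq v hv ((indeg_zero8 _ _).2 hcon))
  · intro u u' v hu hu'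
    have hv : v ∈ T.verts := T.head_mem _ hu
    have : T.indeg v ≤ 1 := by
      by_cases hX : v ∈ X
      · exact ((hleaf v hv).2 hX).2.1.le
      by_cases hr : v = ρ
      · subst hr; omega
      have := hoth v hv hX hr
      have := h2 v hv
      omega
    exact (indeg_le_one8 _ _).1 this u u' hu hu'
  · intro v hv
    rw [← outdeg_zero8]
    constructor
    · intro hX; exact ((hleaf v hv).2 hX).2.2
    · intro h0
      by_contra hX
      by_cases hr : v = ρ
      · subst hr; omega
      have := hoth v hv hX hr
      omega

lemma TL8_subdiv (H K : Dgraph V) (X : Finset V) (ρ : V) (h : TL8 H X ρ)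
    (hs : SubdivideArc H K) : TL8 K X ρ := by
  obtain ⟨u, v, w, huv, hw, hV, hA⟩ := hs
  have hu := H.tail_mem _ huv
  have hv := H.head_mem _ huv
  simp only at hu hv
  have t1 : ∀ x, (x, w) ∉ H.arcs := fun x hx => hw (H.head_mem _ hx)
  have t2 : ∀ x, (w, x) ∉ H.arcs := fun x hx => hw (H.tail_mem _ hx)
  have hm : ∀ x y, (x, y) ∈ K.arcs ↔ (x = u ∧ y = w) ∨ (x = w ∧ y = v) ∨
      ((x, y) ∈ H.arcs ∧ ¬ (x = u ∧ y = v)) := by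
    intro x y
    rw [hA]; simp; tauto
  obtain ⟨r1, r2, r3, r4, r5, r6, r7⟩ := h
  refine ⟨?_, r2, ?_, ?_, ?_, ?_, ?_⟩
  · rw [hV]; simp [r1]
  · intro x; rw [hm]
    have := r3 x
    have := r3 u
    grind
  · intro x hx hxρ
    rw [hV, Finset.mem_insert] at hx
    rcases hx with rfl | hx
    · exact ⟨u, by rw [hm]; simp⟩
    · obtain ⟨y, hy⟩ := r4 x hx hxρ
      by_cases hc : y = u ∧ x = v
      · exact ⟨w, by rw [hm]; simp [hc]⟩
      · exact ⟨y, by rw [hm]; simp [hc, hy]⟩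
  · intro x x' y
    rw [hm, hm]
    have := r5 x x' y
    have := r5 x u y
    have := r5 u x' y
    grind
  · intro x hx
    rw [hV, Finset.mem_insert] at hx
    rcases hx with rfl | hx
    · constructor
      · intro hX; exact absurd (r7 hX) hw
      · intro hh; exact absurd ((hm x v).2 (by simp)) (hh v)
    · rw [r6 x hx]
      have hxw : x ≠ w := by rintro rfl; exact hw hx
      constructor
      · intro hh y; rw [hm]
        have := hh y
        grind
      · intro hh y hy
        have h1 := hh y
        have h2 := hh w
        rw [hm] at h1 h2
        grind
  · rw [hV]; exact r7.trans (Finset.subset_insert _ _)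

lemma TL8_of_subdivision (T τ : Dgraph V) (X : Finset V) (ρ : V) (hs : IsSubdivisionOf T τ)
    (h : TL8 T X ρ) : TL8 τ X ρ := by
  induction hs with
  | refl => exact h
  | step _ h2 ih => exact TL8_subdiv _ _ _ _ ih h2

lemma exists_RBPT8 (X : Finset V) (ρ : V) (hX : X.Nonempty) (n : ℕ) : ∀ τ : Dgraph V,
    τ.verts.card ≤ n → TL8 τ X ρ →
    τ.Acyclic → (∀ v a b c, (v, a) ∈ τ.arcs → (v, b) ∈ τ.arcs → (v, c) ∈ τ.arcs →
      a = b ∨ a = c ∨ b = c) → ∃ T : Dgraph V, IsRBPT T X ∧ IsSubdivisionOf T τ := by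
  induction n with
  | zero =>
    intro τ hc h
    have := h.root_mem
    simp at hc
    simp [hc] at this
  | succ n ih =>
    intro τ hcard h hac h2
    by_cases hex : ∃ w ∈ τ.verts, w ≠ ρ ∧ τ.outdeg w = 1
    · obtain ⟨w, hw, hwρ, ho⟩ := hex
      obtain ⟨u, hu⟩ := h.par w hw hwρ
      have : ∃ v, (w, v) ∈ τ.arcs := by
        by_contra hcon
        push Not at hcon
        have := (outdeg_zero8 _ _).2 hcon
        omega
      obtain ⟨v, hv⟩ := this
      have ho' := (outdeg_le_one8 _ _).1 ho.le
      have irr : ∀ x, (x, x) ∉ τ.arcs := fun x hx => hac x (Relation.TransGen.single hx)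
      have huw : u ≠ w := by rintro rfl; exact irr _ hu
      have hvw : v ≠ w := by rintro rfl; exact irr _ hv
      have huv : (u, v) ∉ τ.arcs := fun hh => huw (h.paru _ _ _ hh hv)
      have hiw : ∀ x, (x, w) ∈ τ.arcs → x = u := fun x hx => h.paru _ _ _ hx hu
      have how : ∀ x, (w, x) ∈ τ.arcs → x = v := fun x hx => ho' _ _ hx hv
      have huV := τ.tail_mem _ hu
      have hvV := τ.head_mem _ hv
      simp only at huV hvV
      let H : Dgraph V :=
        { verts := τ.verts.erase w
          arcs := insert (u, v) ((τ.arcs.erase (u, w)).erase (w, v))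
          tail_mem := by
            rintro ⟨x, y⟩ ha
            simp only [Finset.mem_insert, Finset.mem_erase, ne_eq, Prod.mk.injEq] at ha ⊢
            rcases ha with ⟨rfl, rfl⟩ | ⟨h1, h2, h3⟩
            · exact ⟨huw, huV⟩
            · refine ⟨?_, τ.tail_mem _ h3⟩
              rintro rfl
              exact h1 ⟨rfl, how _ h3⟩
          head_mem := by
            rintro ⟨x, y⟩ ha
            simp only [Finset.mem_insert, Finset.mem_erase, ne_eq, Prod.mk.injEq] at ha ⊢
            rcases ha with ⟨rfl, rfl⟩ | ⟨h1, h2, h3⟩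
            · exact ⟨hvw, hvV⟩
            · refine ⟨?_, τ.head_mem _ h3⟩
              rintro rfl
              exact h2 ⟨hiw _ h3, rfl⟩ }
      have hm : ∀ x y, (x, y) ∈ H.arcs ↔ (x = u ∧ y = v) ∨
          ((x, y) ∈ τ.arcs ∧ x ≠ w ∧ y ≠ w) := by
        intro x y
        simp only [H, Finset.mem_insert, Finset.mem_erase, ne_eq, Prod.mk.injEq]
        constructor
        · rintro (h1 | ⟨h1, h2, h3⟩)
          · exact Or.inl h1
          · refine Or.inr ⟨h3, ?_, ?_⟩
            · rintro rfl; exact h1 ⟨rfl, how _ h3⟩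
            · rintro rfl; exact h2 ⟨hiw _ h3, rfl⟩
        · rintro (h1 | ⟨h1, h2, h3⟩)
          · exact Or.inl h1
          · exact Or.inr ⟨fun h => h2 h.1, fun h => h3 h.2, h1⟩
      have hHV : ∀ x, x ∈ H.verts ↔ x ≠ w ∧ x ∈ τ.verts := by
        intro x; simp [H]
      have hsd : SubdivideArc H τ := by
        refine ⟨u, v, w, (hm _ _).2 (by simp), by simp [H], ?_, ?_⟩
        · simp [H, Finset.insert_erase hw]
        · ext ⟨x, y⟩
          simp only [Finset.mem_insert, Finset.mem_erase, ne_eq, Prod.mk.injEq, hm]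
          have := how y
          have := hiw x
          grind
      have hTL : TL8 H X ρ := by
        obtain ⟨r1, r2, r3, r4, r5, r6, r7⟩ := h
        have hwX : w ∉ X := fun hh => ((r6 w hw).1 hh) v hv
        refine ⟨(hHV _).2 ⟨hwρ.symm, r1⟩, r2, ?_, ?_, ?_, ?_, ?_⟩
        · intro x; rw [hm]
          have := r3 x
          have := r3 w
          grind
        · intro x hx hxρ
          rw [hHV] at hx
          obtain ⟨y, hy⟩ := r4 x hx.2 hxρ
          by_cases hc : y = w
          · subst hc
            exact ⟨u, by rw [hm]; left; exact ⟨rfl, how _ hy⟩⟩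
          · exact ⟨y, by rw [hm]; right; exact ⟨hy, hc, hx.1⟩⟩
        · intro x x' y
          rw [hm, hm]
          have := r5 x x' y
          have := r5 x w y
          have := r5 x' w y
          grind
        · intro x hx
          rw [hHV] at hx
          rw [r6 x hx.2]
          constructor
          · intro hh y; rw [hm]
            have h1 := hh y
            have h2 := hh w
            grind
          · intro hh y hy
            have h1 := hh y
            have h2 := hh v
            rw [hm] at h1 h2
            have := hiw x
            grind
        · intro x hx
          rw [hHV]
          exact ⟨by rintro rfl; exact hwX hx, r7 hx⟩
      have hHac : H.Acyclic := by
        intro x hx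
        apply hac x
        have : ∀ a b, (a, b) ∈ H.arcs →
            Relation.TransGen (fun u w => (u, w) ∈ τ.arcs) a b := by
          intro a b hab
          rw [hm] at hab
          rcases hab with ⟨rfl, rfl⟩ | hab
          · exact Relation.TransGen.tail (Relation.TransGen.single hu) hv
          · exact Relation.TransGen.single hab.1
        have key : ∀ a b, Relation.TransGen (fun u w => (u, w) ∈ H.arcs) a b →
            Relation.TransGen (fun u w => (u, w) ∈ τ.arcs) a b := by
          intro a b hab
          induction hab with
          | single h => exact this _ _ h
          | tail _ h ih => exact ih.trans (this _ _ h)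
        exact key x x hx
      have hH2 : ∀ v a b c, (v, a) ∈ H.arcs → (v, b) ∈ H.arcs → (v, c) ∈ H.arcs →
          a = b ∨ a = c ∨ b = c := by
        intro x a b c
        rw [hm, hm, hm]
        have := h2 x a b c
        have := h2 x w b c
        have := h2 x a w c
        have := h2 x a b w
        grind
      have hcH : H.verts.card ≤ n := by
        simp only [H, Finset.card_erase_of_mem hw]; omega
      obtain ⟨T, hT, hTs⟩ := ih H hcH hTL hHac hH2
      exact ⟨T, hT, hTs.step hsd⟩
    · push Not at hex
      have hin : ∀ v ∈ τ.verts, v ≠ ρ → τ.indeg v = 1 := by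
        intro v hv hvρ
        have h1 := (indeg_le_one8 τ v).2 (fun _ _ => h.paru _ _ _)
        obtain ⟨u, hu⟩ := h.par v hv hvρ
        have : τ.indeg v ≠ 0 := fun h0 => (indeg_zero8 _ _).1 h0 u hu
        omega
      have hr0 : τ.indeg ρ = 0 := (indeg_zero8 _ _).2 h.root
      have hout : ∀ v ∈ τ.verts, (v ∈ X ↔ τ.outdeg v = 0) := by
        intro v hv; rw [outdeg_zero8]; exact h.leaf v hv
      have hle2 : ∀ v, τ.outdeg v ≤ 2 := fun v => (outdeg_le_two8 _ _).2 (h2 v)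
      refine ⟨τ, ⟨⟨hac, hX, h.sub, ρ, h.root_mem, hr0, ?_, ?_, ?_, ?_⟩, ?_⟩, .refl _⟩
      · have := mt (hout ρ h.root_mem).2 h.root_X
        have := hle2 ρ
        omega
      · intro v hv h0
        by_contra hc
        have := hin v hv hc
        omega
      · intro v hv
        constructor
        · intro hl; exact (hout v hv).2 hl.2.2
        · intro hl
          refine ⟨hv, hin v hv ?_, (hout v hv).1 hl⟩
          rintro rfl; exact h.root_X hl
      · intro v hv hvX hvρ
        left
        refine ⟨hin v hv hvρ, ?_⟩
        have := mt (hout v hv).2 hvX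
        have := hle2 v
        have := hex v hv hvρ
        omega
      · intro v hv
        by_cases hc : v = ρ
        · subst hc; omega
        · have := hin v hv hc; omega

lemma support_iff8 (N : Dgraph V) (X : Finset V) (hN : IsRBPN N X) (τ : Dgraph V) :
    IsSupportTree N X τ ↔ τ.verts = N.verts ∧ Adm8 N.arcs τ.arcs := by
  obtain ⟨hac, hne, hsub, ρ, hρ, hin, hout, huniq, hleaf, hoth⟩ := hN
  have hρX : ρ ∉ X := by
    intro hX
    have := ((hleaf ρ hρ).2 hX).2.1
    omega
  have hr := (indeg_zero8 _ _).1 hin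
  have hX0 : ∀ v ∈ X, ∀ w, (v, w) ∉ N.arcs := fun v hv =>
    (outdeg_zero8 _ _).1 ((hleaf v (hsub hv)).2 hv).2.2
  have hnX : ∀ v ∈ N.verts, v ∉ X → N.outdeg v = 1 ∨ N.outdeg v = 2 := by
    intro v hv hX
    by_cases h : v = ρ
    · subst h; exact hout
    · have := hoth v hv hX h; omega
  have ho2 : ∀ v ∈ N.verts, N.outdeg v ≤ 2 := by
    intro v hv
    by_cases h : v ∈ X
    · have := ((hleaf v hv).2 h).2.2; omega
    · have := hnX v hv h; omega
  have hi2 : ∀ v ∈ N.verts, v ≠ ρ → N.indeg v = 1 ∨ N.indeg v = 2 := by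
    intro v hv hv'
    by_cases h : v ∈ X
    · have := ((hleaf v hv).2 h).2.1; omega
    · have := hoth v hv h hv'; omega
  constructor
  · rintro ⟨hV, hA, T, hT, hs⟩
    refine ⟨hV, hA, ?_⟩
    obtain ⟨ρ', hTL⟩ := TL8_of_RBPT T X hT
    have h := TL8_of_subdivision T τ X ρ' hs hTL
    have : ρ = ρ' := by
      by_contra hc
      obtain ⟨u, hu⟩ := h.par ρ (hV ▸ hρ) hc
      exact hr u (hA hu)
    subst this
    have hpar : ∀ a ∈ N.arcs, ∃ u, (u, a.2) ∈ τ.arcs := by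
      rintro ⟨x, y⟩ ha
      refine h.par y (hV ▸ N.head_mem _ ha) ?_
      rintro rfl; exact hr _ ha
    have hch : ∀ a ∈ N.arcs, ∃ u, (a.1, u) ∈ τ.arcs := by
      rintro ⟨x, y⟩ ha
      by_contra hc
      push Not at hc
      exact hX0 x ((h.leaf x (hV ▸ N.tail_mem _ ha)).2 hc) y ha
    refine ⟨?_, ?_, ?_, ?_⟩
    · intro a ha hu
      obtain ⟨u, hu'⟩ := hpar a ha
      rw [← hu _ (hA hu') rfl]; exact hu'
    · intro a ha hu
      obtain ⟨u, hu'⟩ := hch a ha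
      rw [← hu _ (hA hu') rfl]; exact hu'
    · rintro ⟨a, y⟩ ha ⟨b, y'⟩ hb hab (rfl : y = y')
      obtain ⟨u, hu⟩ := hpar _ ha
      have hyρ : y ≠ ρ := by rintro rfl; exact hr _ ha
      have := (indeg_le_two8 N y).1 (by have := hi2 y (N.head_mem _ ha) hyρ; omega) a b u ha hb (hA hu)
      have := h.paru a b y
      grind
    · rintro ⟨x, a⟩ ha ⟨x', b⟩ hb hab (rfl : x = x')
      obtain ⟨u, hu⟩ := hch _ ha
      have := (outdeg_le_two8 N x).1 (ho2 x (N.tail_mem _ ha)) a b u ha hb (hA hu)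
      grind
  · rintro ⟨hV, hA, h1, h2, h3, h4⟩
    refine ⟨hV, hA, exists_RBPT8 X ρ hne _ τ le_rfl ?_ ?_ ?_⟩
    · refine ⟨hV ▸ hρ, hρX, fun u hu => hr u (hA hu), ?_, ?_, ?_, hV ▸ hsub⟩
      · intro v hv hvρ
        rw [hV] at hv
        have : N.indeg v ≠ 0 := by have := hi2 v hv hvρ; omega
        rw [Ne, indeg_zero8] at this
        push Not at this
        obtain ⟨u, hu⟩ := this
        by_cases hc : ∀ b ∈ N.arcs, b.2 = v → b = (u, v)
        · exact ⟨u, h1 _ hu hc⟩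
        · push Not at hc
          obtain ⟨⟨u', v'⟩, hb, rfl, hne⟩ := hc
          have := h3 _ hb _ hu hne rfl
          by_cases hh : (u, v') ∈ τ.arcs
          · exact ⟨u, hh⟩
          · exact ⟨u', this.2 hh⟩
      · intro u u' v hu hu'
        by_contra hc
        exact (h3 _ (hA hu) _ (hA hu') (by simpa using hc) rfl).1 hu hu'
      · intro v hv
        rw [hV] at hv
        constructor
        · intro hX w hw; exact hX0 v hX w (hA hw)
        · intro hh
          by_contra hX
          have : N.outdeg v ≠ 0 := by have := hnX v hv hX; omega
          rw [Ne, outdeg_zero8] at this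
          push Not at this
          obtain ⟨u, hu⟩ := this
          by_cases hc : ∀ b ∈ N.arcs, b.1 = v → b = (v, u)
          · exact hh u (h2 _ hu hc)
          · push Not at hc
            obtain ⟨⟨v', u'⟩, hb, rfl, hne⟩ := hc
            have := h4 _ hb _ hu hne rfl
            exact this.elim (hh _) (hh _)
    · intro v hv
      exact hac v (Relation.TransGen.mono (fun a b hab => hA hab) v v hv)
    · intro v a b c ha hb hc
      exact (outdeg_le_two8 N v).1 (ho2 v (N.tail_mem _ (hA ha))) a b c (hA ha) (hA hb) (hA hc)

lemma uniq8 (N : Dgraph V) (X : Finset V) (hN : IsRBPN N X) :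
    (∀ a ∈ N.arcs, ∀ b ∈ N.arcs, ∀ c ∈ N.arcs, a ≠ b → a ≠ c → a.2 = b.2 → a.2 = c.2 → b = c) ∧
    (∀ a ∈ N.arcs, ∀ b ∈ N.arcs, ∀ c ∈ N.arcs, a ≠ b → a ≠ c → a.1 = b.1 → a.1 = c.1 → b = c) := by
  obtain ⟨hac, hne, hsub, ρ, hρ, hin, hout, huniq, hleaf, hoth⟩ := hN
  have key : ∀ v ∈ N.verts, N.indeg v ≤ 2 ∧ N.outdeg v ≤ 2 := by
    intro v hv
    by_cases h : v ∈ X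
    · have := ((hleaf v hv).2 h).2; omega
    by_cases h' : v = ρ
    · subst h'; omega
    · have := hoth v hv h h'; omega
  constructor
  · rintro ⟨a, y⟩ ha ⟨b, y'⟩ hb ⟨c, y''⟩ hc h1 h2 (rfl : y = y') (rfl : y = y'')
    have := (indeg_le_two8 N y).1 (key y (N.head_mem _ ha)).1 a b c ha hb hc
    grind
  · rintro ⟨y, a⟩ ha ⟨y', b⟩ hb ⟨y'', c⟩ hc h1 h2 (rfl : y = y') (rfl : y = y'')
    have := (outdeg_le_two8 N y).1 (key y (N.tail_mem _ ha)).2 a b c ha hb hc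
    grind

end
section
variable {V : Type*} [DecidableEq V]

structure Part8 (A : Finset (V × V)) (ZT : Finset (Finset (V × V))) : Prop where
  sub : ∀ Z ∈ ZT, Z ⊆ A
  cov : ∀ a ∈ A, ∃ Z ∈ ZT, a ∈ Z
  dis : ∀ Z ∈ ZT, ∀ Z' ∈ ZT, ∀ a, a ∈ Z → a ∈ Z' → Z = Z'
  clo : ∀ Z ∈ ZT, ∀ a ∈ Z, ∀ b ∈ A, (a.2 = b.2 ∨ a.1 = b.1) → b ∈ Z

lemma adm_local8 {A : Finset (V × V)} {ZT : Finset (Finset (V × V))} (h : Part8 A ZT)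
    (S : Finset (V × V)) : Adm8 A S ↔ S ⊆ A ∧ ∀ Z ∈ ZT, Adm8 Z (S ∩ Z) := by
  constructor
  · rintro ⟨h0, h1, h2, h3, h4⟩
    refine ⟨h0, fun Z hZ => ⟨Finset.inter_subset_right, ?_, ?_, ?_, ?_⟩⟩
    · intro a ha hu
      refine Finset.mem_inter.2 ⟨h1 a (h.sub Z hZ ha) ?_, ha⟩
      intro b hb hab
      exact hu b (h.clo Z hZ a ha b hb (Or.inl hab.symm)) hab
    · intro a ha hu
      refine Finset.mem_inter.2 ⟨h2 a (h.sub Z hZ ha) ?_, ha⟩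
      intro b hb hab
      exact hu b (h.clo Z hZ a ha b hb (Or.inr hab.symm)) hab
    · intro a ha b hb hab he
      have := h3 a (h.sub Z hZ ha) b (h.sub Z hZ hb) hab he
      simp [ha, hb, this]
    · intro a ha b hb hab he
      have := h4 a (h.sub Z hZ ha) b (h.sub Z hZ hb) hab he
      simpa [ha, hb] using this
  · rintro ⟨h0, hh⟩
    refine ⟨h0, ?_, ?_, ?_, ?_⟩
    · intro a ha hu
      obtain ⟨Z, hZ, haZ⟩ := h.cov a ha
      exact (Finset.mem_inter.1 ((hh Z hZ).2.1 a haZ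
        (fun b hb => hu b (h.sub Z hZ hb)))).1
    · intro a ha hu
      obtain ⟨Z, hZ, haZ⟩ := h.cov a ha
      exact (Finset.mem_inter.1 ((hh Z hZ).2.2.1 a haZ
        (fun b hb => hu b (h.sub Z hZ hb)))).1
    · intro a ha b hb hab he
      obtain ⟨Z, hZ, haZ⟩ := h.cov a ha
      have hbZ := h.clo Z hZ a haZ b hb (Or.inl he)
      have := (hh Z hZ).2.2.2.1 a haZ b hbZ hab he
      simpa [haZ, hbZ] using this
    · intro a ha b hb hab he
      obtain ⟨Z, hZ, haZ⟩ := h.cov a ha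
      have hbZ := h.clo Z hZ a haZ b hb (Or.inr he)
      have := (hh Z hZ).2.2.2.2 a haZ b hbZ hab he
      simpa [haZ, hbZ] using this

open Classical in
lemma count_prod8 {A : Finset (V × V)} {ZT : Finset (Finset (V × V))} (h : Part8 A ZT) :
    (A.powerset.filter (Adm8 A)).card = ∏ Z ∈ ZT, (Z.powerset.filter (Adm8 Z)).card := by
  rw [← Finset.card_pi]
  refine Finset.card_bij (fun S _ => fun Z _ => S ∩ Z) ?_ ?_ ?_
  · intro S hS
    rw [Finset.mem_filter, adm_local8 h] at hS
    rw [Finset.mem_pi]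
    intro Z hZ
    rw [Finset.mem_filter]
    exact ⟨Finset.mem_powerset.2 Finset.inter_subset_right, hS.2.2 Z hZ⟩
  · intro S hS S' hS' he
    rw [Finset.mem_filter, Finset.mem_powerset] at hS hS'
    have key : ∀ Z (hZ : Z ∈ ZT), S ∩ Z = S' ∩ Z := fun Z hZ => congrFun (congrFun he Z) hZ
    ext a
    constructor
    · intro ha
      obtain ⟨Z, hZ, haZ⟩ := h.cov a (hS.1 ha)
      have : a ∈ S ∩ Z := Finset.mem_inter.2 ⟨ha, haZ⟩
      rw [key Z hZ] at this
      exact (Finset.mem_inter.1 this).1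
    · intro ha
      obtain ⟨Z, hZ, haZ⟩ := h.cov a (hS'.1 ha)
      have : a ∈ S' ∩ Z := Finset.mem_inter.2 ⟨ha, haZ⟩
      rw [← key Z hZ] at this
      exact (Finset.mem_inter.1 this).1
  · intro f hf
    rw [Finset.mem_pi] at hf
    have hf' : ∀ Z (hZ : Z ∈ ZT), f Z hZ ⊆ Z ∧ Adm8 Z (f Z hZ) := by
      intro Z hZ
      have := hf Z hZ
      rw [Finset.mem_filter, Finset.mem_powerset] at this
      exact this
    have hS : ∀ Z (hZ : Z ∈ ZT), (A.filter (fun a => ∃ Z, ∃ hZ : Z ∈ ZT, a ∈ f Z hZ)) ∩ Z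
        = f Z hZ := by
      intro Z hZ
      ext a
      rw [Finset.mem_inter, Finset.mem_filter]
      constructor
      · rintro ⟨⟨_, Z', hZ', ha⟩, haZ⟩
        have := h.dis Z hZ Z' hZ' a haZ ((hf' Z' hZ').1 ha)
        subst this
        exact ha
      · intro ha
        have haZ := (hf' Z hZ).1 ha
        exact ⟨⟨h.sub Z hZ haZ, Z, hZ, ha⟩, haZ⟩
    refine ⟨A.filter (fun a => ∃ Z, ∃ hZ : Z ∈ ZT, a ∈ f Z hZ), ?_, ?_⟩
    · rw [Finset.mem_filter, adm_local8 h]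
      refine ⟨Finset.mem_powerset.2 (Finset.filter_subset _ _), Finset.filter_subset _ _, ?_⟩
      intro Z hZ
      rw [hS Z hZ]
      exact (hf' Z hZ).2
    · funext Z hZ
      exact hS Z hZ

def U8 (A : Finset (V × V)) : Prop :=
    (∀ a ∈ A, ∀ b ∈ A, ∀ c ∈ A, a ≠ b → a ≠ c → a.2 = b.2 → a.2 = c.2 → b = c) ∧
    (∀ a ∈ A, ∀ b ∈ A, ∀ c ∈ A, a ≠ b → a ≠ c → a.1 = b.1 → a.1 = c.1 → b = c)

lemma chain_closed8 {R : V × V → V × V → Prop} (hR : ∀ a b, R a b → R b a)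
    (P : V × V → Prop) (l : List (V × V)) (hl : l.IsChain R)
    (hP : ∀ a ∈ l, ∀ b ∈ l, R a b → P a → P b) (a : V × V) (ha : a ∈ l) (hPa : P a) :
    ∀ b ∈ l, P b := by
  rw [List.isChain_iff_getElem] at hl
  have key : ∀ i j (hi : i < l.length) (hj : j < l.length), i ≤ j → (P l[i] ↔ P l[j]) := by
    intro i j hi hj hij
    induction j, hij using Nat.le_induction with
    | base => rfl
    | succ k hk ih =>
      rw [ih (by omega)]
      have := hl k hj
      exact ⟨hP _ (by simp) _ (by simp) this, hP _ (by simp) _ (by simp) (hR _ _ this)⟩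
  intro b hb
  obtain ⟨i, hi, rfl⟩ := List.mem_iff_getElem.1 ha
  obtain ⟨j, hj, rfl⟩ := List.mem_iff_getElem.1 hb
  rcases le_total i j with h | h
  · exact (key i j hi hj h).1 hPa
  · exact (key j i hj hi h).2 hPa

lemma max_closed8 (N : Dgraph V) (hU : U8 N.arcs) (Z : Finset (V × V)) (hZ : IsMaxZigzag N Z) :
    ∀ a ∈ Z, ∀ b ∈ N.arcs, (a.2 = b.2 ∨ a.1 = b.1) → b ∈ Z := by
  intro a ha b hb hab
  by_contra hbZ
  obtain ⟨⟨hsub, l, hl0, hnd, hlZ, hch⟩, hmax⟩ := hZ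
  change l.IsChain _ at hch
  have hmem : ∀ x, x ∈ l ↔ x ∈ Z := by intro x; rw [← hlZ]; simp
  have hbl : b ∉ l := by rwa [hmem]
  have hcontra : ∀ l' : List (V × V), l'.Nodup → (∀ x, x ∈ l' ↔ x = b ∨ x ∈ l) →
      l'.IsChain (fun a b => a.2 = b.2 ∨ a.1 = b.1) → False := by
    intro l' h1 h2 h3
    have : IsZigzag N l'.toFinset := by
      refine ⟨?_, l', ?_, h1, rfl, h3⟩
      · intro x hx
        rw [List.mem_toFinset, h2, hmem] at hx
        rcases hx with rfl | hx
        · exact hb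
        · exact hsub hx
      · rintro rfl
        have := (h2 b).2 (Or.inl rfl)
        simp at this
    have h4 := hmax _ this (by
      intro x hx; rw [List.mem_toFinset, h2, hmem]; exact Or.inr hx)
    apply hbZ
    rw [← h4, List.mem_toFinset, h2]
    exact Or.inl rfl
  have hch' := List.isChain_iff_getElem.1 hch
  obtain ⟨i, hi, rfl⟩ := List.mem_iff_getElem.1 ((hmem a).2 ha)
  by_cases h0 : i = 0
  · subst h0
    refine hcontra (b :: l) (List.nodup_cons.2 ⟨hbl, hnd⟩) (by simp) ?_
    cases l with
    | nil => simp at hi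
    | cons x t =>
      rw [List.isChain_cons_cons]
      refine ⟨?_, hch⟩
      simp only [List.getElem_cons_zero] at hab
      rcases hab with h | h
      · exact Or.inl h.symm
      · exact Or.inr h.symm
  by_cases h1 : i + 1 = l.length
  · refine hcontra (l ++ [b]) ?_ (by simp; grind) ?_
    · rw [List.nodup_append]
      refine ⟨hnd, by simp, ?_⟩
      intro x hx y hy
      rw [List.mem_singleton] at hy
      subst hy; rintro rfl; exact hbl hx
    · rw [List.isChain_append]
      refine ⟨hch, by simp, ?_⟩
      intro x hx y hy
      simp at hy
      subst hy
      rw [List.getLast?_eq_getElem?] at hx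
      have : l.length - 1 = i := by omega
      rw [this] at hx
      simp [hi] at hx
      subst hx
      exact hab
  · obtain ⟨j, rfl⟩ : ∃ j, i = j + 1 := ⟨i - 1, by omega⟩
    have hm : ∀ k (hk : k < l.length), l[k] ∈ N.arcs := fun k hk =>
      hsub ((hmem _).1 (List.getElem_mem hk))
    have e1 := hch' j (by omega)
    have e2 := hch' (j + 1) (by omega)
    have n1 : l[j + 1] ≠ l[j] := by
      intro h; have := (hnd.getElem_inj_iff).1 h; omega
    have n2 : l[j + 1] ≠ l[j + 1 + 1] := by
      intro h; have := (hnd.getElem_inj_iff).1 h; omega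
    have n3 : l[j] ≠ l[j + 1 + 1] := by
      intro h; have := (hnd.getElem_inj_iff).1 h; omega
    have nb : ∀ k (hk : k < l.length), l[k] ≠ b := by
      intro k hk h; exact hbl (h ▸ List.getElem_mem hk)
    have m1 := hm j (by omega)
    have m2 := hm (j+1) (by omega)
    have m3 := hm (j+1+1) (by omega)
    have nb1 := nb j (by omega)
    have nb2 := nb (j+1) (by omega)
    have nb3 := nb (j+1+1) (by omega)
    have u1 := hU.1 _ m2 _ m1 _ m3 n1 n2
    have u2 := hU.2 _ m2 _ m1 _ m3 n1 n2
    have u3 := hU.1 _ m2 _ m1 _ hb n1 nb2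
    have u4 := hU.2 _ m2 _ m1 _ hb n1 nb2
    have u5 := hU.1 _ m2 _ m3 _ hb n2 nb2
    have u6 := hU.2 _ m2 _ m3 _ hb n2 nb2
    grind

lemma part8 (N : Dgraph V) (hU : U8 N.arcs) (ZT : Finset (Finset (V × V)))
    (hZT : ∀ Z : Finset (V × V), Z ∈ ZT ↔ Dgraph.IsMaxZigzag N Z) : Part8 N.arcs ZT := by
  have hclo : ∀ Z ∈ ZT, ∀ a ∈ Z, ∀ b ∈ N.arcs, (a.2 = b.2 ∨ a.1 = b.1) → b ∈ Z :=
    fun Z hZ => max_closed8 N hU Z ((hZT Z).1 hZ)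
  refine ⟨fun Z hZ => ((hZT Z).1 hZ).1.1, ?_, ?_, hclo⟩
  · intro a ha
    have h0 : IsZigzag N {a} := ⟨by simpa using ha, [a], by simp, by simp, by simp, by
      change List.IsChain _ _; simp⟩
    have hfin : {Z | IsZigzag N Z}.Finite :=
      (Finset.finite_toSet N.arcs.powerset).subset (fun Z hZ => by simpa using hZ.1)
    obtain ⟨Z, hle, hZ⟩ := hfin.exists_le_maximal h0
    refine ⟨Z, (hZT Z).2 ⟨hZ.1, ?_⟩, hle (by simp)⟩
    intro Z' hZ' hs
    exact le_antisymm (hZ.2 hZ' hs) hs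
  · have key : ∀ Z ∈ ZT, ∀ Z' ∈ ZT, ∀ a, a ∈ Z → a ∈ Z' → Z ⊆ Z' := by
      intro Z hZ Z' hZ' a ha ha'
      obtain ⟨⟨hsub, l, hl0, hnd, hlZ, hch⟩, hmax⟩ := (hZT Z).1 hZ
      change l.IsChain _ at hch
      have hmem : ∀ x, x ∈ l ↔ x ∈ Z := by intro x; rw [← hlZ]; simp
      intro b hb
      refine chain_closed8 ?_ (fun x => x ∈ Z') l hch ?_ a ((hmem a).2 ha) ha' b ((hmem b).2 hb)
      · rintro x y (h | h)
        · exact Or.inl h.symm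
        · exact Or.inr h.symm
      · intro x hx y hy hxy hxZ
        exact hclo Z' hZ' x hxZ y (hsub ((hmem y).1 hy)) hxy
    intro Z hZ Z' hZ' a ha ha'
    exact (key Z hZ Z' hZ' a ha ha').antisymm (key Z' hZ' Z hZ a ha' ha)

end
open Classical in
lemma ncard8 {V : Type*} [DecidableEq V] (N : Dgraph V) (X : Finset V) (hN : IsRBPN N X) :
    {τ : Dgraph V | IsSupportTree N X τ}.ncard = (N.arcs.powerset.filter (Adm8 N.arcs)).card := by
  rw [← Set.ncard_coe_finset]
  refine Set.ncard_congr (fun τ _ => τ.arcs) ?_ ?_ ?_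
  · intro τ hτ
    have := (support_iff8 N X hN τ).1 hτ
    simp only [Finset.coe_filter, Finset.mem_powerset, Set.mem_ofPred_eq]
    exact ⟨this.2.1, this.2⟩
  · intro τ τ' h h' he
    have h1 := ((support_iff8 N X hN τ).1 h).1
    have h2 := ((support_iff8 N X hN τ').1 h').1
    cases τ; cases τ'
    simp only at h1 h2 he
    subst he; subst h1; subst h2; rfl
  · intro S hS
    simp only [Finset.coe_filter, Finset.mem_powerset, Set.mem_ofPred_eq] at hS
    exact ⟨⟨N.verts, S, fun a ha => N.tail_mem a (hS.1 ha), fun a ha => N.head_mem a (hS.1 ha)⟩,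
      (support_iff8 N X hN _).2 ⟨rfl, hS.2⟩, rfl⟩
section
variable {V : Type*} [DecidableEq V]

structure Sq8 (Z : Finset (V × V)) (a : ℕ → V × V) (m p : ℕ) : Prop where
  pos : 0 < m
  mem : ∀ x, x ∈ Z ↔ ∃ i, i < m ∧ a i = x
  inj : ∀ i j, i < m → j < m → a i = a j → i = j
  tl : ∀ i, i + 1 < m → (i + p) % 2 = 0 → (a i).1 = (a (i + 1)).1
  hd : ∀ i, i + 1 < m → (i + p) % 2 = 1 → (a i).2 = (a (i + 1)).2

def Link8 (b : ℕ → Prop) (m p : ℕ) : Prop :=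
  ∀ i, i + 1 < m → ((i + p) % 2 = 0 → b i ∨ b (i + 1)) ∧ ((i + p) % 2 = 1 → (b i ↔ ¬ b (i + 1)))

def Cyc8 (a : ℕ → V × V) (m : ℕ) : Prop :=
  3 ≤ m ∧ ((a 0).2 = (a (m - 1)).2 ∨ (a 0).1 = (a (m - 1)).1)

lemma Sq8.mem' {Z : Finset (V × V)} {a : ℕ → V × V} {m p : ℕ} (h : Sq8 Z a m p) {i : ℕ}
    (hi : i < m) : a i ∈ Z := (h.mem _).2 ⟨i, hi, rfl⟩

lemma Sq8.ne {Z : Finset (V × V)} {a : ℕ → V × V} {m p : ℕ} (h : Sq8 Z a m p) {i j : ℕ}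
    (hi : i < m) (hj : j < m) (hij : i ≠ j) : a i ≠ a j := fun he => hij (h.inj _ _ hi hj he)

lemma Sq8.card {Z : Finset (V × V)} {a : ℕ → V × V} {m p : ℕ} (h : Sq8 Z a m p) :
    Z.card = m := by
  have : Z = (Finset.range m).image a := by
    ext x; rw [h.mem]; simp
  rw [this, Finset.card_image_of_injOn, Finset.card_range]
  intro i hi j hj hij
  simp at hi hj
  exact h.inj i j hi hj hij

lemma Sq8.uh {Z : Finset (V × V)} {a : ℕ → V × V} {m p : ℕ} (h : Sq8 Z a m p) (hU : U8 Z)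
    {i j k : ℕ} (hi : i < m) (hj : j < m) (hk : k < m) (hij : i ≠ j) (hik : i ≠ k)
    (e1 : (a i).2 = (a j).2) (e2 : (a i).2 = (a k).2) : j = k :=
  h.inj _ _ hj hk (hU.1 _ (h.mem' hi) _ (h.mem' hj) _ (h.mem' hk) (h.ne hi hj hij)
    (h.ne hi hk hik) e1 e2)

lemma Sq8.ut {Z : Finset (V × V)} {a : ℕ → V × V} {m p : ℕ} (h : Sq8 Z a m p) (hU : U8 Z)
    {i j k : ℕ} (hi : i < m) (hj : j < m) (hk : k < m) (hij : i ≠ j) (hik : i ≠ k)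
    (e1 : (a i).1 = (a j).1) (e2 : (a i).1 = (a k).1) : j = k :=
  h.inj _ _ hj hk (hU.2 _ (h.mem' hi) _ (h.mem' hj) _ (h.mem' hk) (h.ne hi hj hij)
    (h.ne hi hk hik) e1 e2)

lemma Sq8.both {Z : Finset (V × V)} {a : ℕ → V × V} {m p : ℕ} (h : Sq8 Z a m p)
    {i j : ℕ} (hi : i < m) (hj : j < m) (hij : i ≠ j)
    (e1 : (a i).1 = (a j).1) (e2 : (a i).2 = (a j).2) : False :=
  h.ne hi hj hij (Prod.ext e1 e2)

/-- interior arcs have no further neighbours -/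
lemma Sq8.mid {Z : Finset (V × V)} {a : ℕ → V × V} {m p : ℕ} (h : Sq8 Z a m p) (hU : U8 Z)
    {i j : ℕ} (hi : i + 2 < m) (hj : j < m) (hij : i + 1 ≠ j)
    (e : (a (i + 1)).2 = (a j).2 ∨ (a (i + 1)).1 = (a j).1) : j = i ∨ j = i + 2 := by
  rcases Nat.mod_two_eq_zero_or_one (i + p) with hp | hp
  · have e1 := h.tl i (by omega) hp
    have e2 := h.hd (i + 1) (by omega) (by omega)
    rcases e with e | e
    · right; exact h.uh hU (by omega) hj (by omega) hij (by omega) e e2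
    · left; exact h.ut hU (by omega) hj (by omega) hij (by omega) e e1.symm
  · have e1 := h.hd i (by omega) hp
    have e2 := h.tl (i + 1) (by omega) (by omega)
    rcases e with e | e
    · left; exact h.uh hU (by omega) hj (by omega) hij (by omega) e e1.symm
    · right; exact h.ut hU (by omega) hj (by omega) hij (by omega) e e2

lemma Sq8.adj {Z : Finset (V × V)} {a : ℕ → V × V} {m p : ℕ} (h : Sq8 Z a m p) (hU : U8 Z)
    {i j : ℕ} (hij : i < j) (hj : j < m)
    (e : (a i).2 = (a j).2 ∨ (a i).1 = (a j).1) : j = i + 1 ∨ (i = 0 ∧ j = m - 1 ∧ 3 ≤ m) := by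
  by_cases hi : i = 0
  · subst hi
    by_cases hjm : j = m - 1
    · omega
    · obtain ⟨k, rfl⟩ : ∃ k, j = k + 1 := ⟨j - 1, by omega⟩
      have := h.mid hU (i := k) (j := 0) (by omega) (by omega) (by omega)
        (e.imp Eq.symm Eq.symm)
      omega
  · obtain ⟨k, rfl⟩ : ∃ k, i = k + 1 := ⟨i - 1, by omega⟩
    have := h.mid hU (i := k) (j := j) (by omega) (by omega) (by omega) e
    omega

lemma Sq8.adjH {Z : Finset (V × V)} {a : ℕ → V × V} {m p : ℕ} (h : Sq8 Z a m p) (hU : U8 Z)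
    {i j : ℕ} (hij : i < j) (hj : j < m) (e : (a i).2 = (a j).2) :
    (j = i + 1 ∧ (i + p) % 2 = 1) ∨ (i = 0 ∧ j = m - 1 ∧ 3 ≤ m) := by
  rcases h.adj hU hij hj (Or.inl e) with rfl | h'
  · left
    refine ⟨rfl, ?_⟩
    by_contra hc
    exact h.both (by omega) hj (by omega) (h.tl i hj (by omega)) e
  · exact Or.inr h'

lemma Sq8.adjT {Z : Finset (V × V)} {a : ℕ → V × V} {m p : ℕ} (h : Sq8 Z a m p) (hU : U8 Z)
    {i j : ℕ} (hij : i < j) (hj : j < m) (e : (a i).1 = (a j).1) :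
    (j = i + 1 ∧ (i + p) % 2 = 0) ∨ (i = 0 ∧ j = m - 1 ∧ 3 ≤ m) := by
  rcases h.adj hU hij hj (Or.inr e) with rfl | h'
  · left
    refine ⟨rfl, ?_⟩
    by_contra hc
    exact h.both (by omega) hj (by omega) e (h.hd i hj (by omega))
  · exact Or.inr h'

lemma Sq8.link {Z : Finset (V × V)} {a : ℕ → V × V} {m p : ℕ} (h : Sq8 Z a m p)
    {S : Finset (V × V)} (hS : Adm8 Z S) : Link8 (fun i => a i ∈ S) m p := by
  obtain ⟨h0, h1, h2, h3, h4⟩ := hS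
  intro i hi
  have hne := h.ne (i := i) (j := i + 1) (by omega) hi (by omega)
  exact ⟨fun hp => h4 _ (h.mem' (by omega)) _ (h.mem' hi) hne (h.tl i hi hp),
    fun hp => h3 _ (h.mem' (by omega)) _ (h.mem' hi) hne (h.hd i hi hp)⟩

/-- pairwise part of admissibility from an ordered version -/
lemma Sq8.adm_of {Z : Finset (V × V)} {a : ℕ → V × V} {m p : ℕ} (h : Sq8 Z a m p)
    {S : Finset (V × V)} (hSZ : S ⊆ Z)
    (h1 : ∀ i, i < m → (∀ j, j < m → (a j).2 = (a i).2 → j = i) → a i ∈ S)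
    (h2 : ∀ i, i < m → (∀ j, j < m → (a j).1 = (a i).1 → j = i) → a i ∈ S)
    (h3 : ∀ i j, i < j → j < m → (a i).2 = (a j).2 → (a i ∈ S ↔ a j ∉ S))
    (h4 : ∀ i j, i < j → j < m → (a i).1 = (a j).1 → (a i ∈ S ∨ a j ∈ S)) : Adm8 Z S := by
  refine ⟨hSZ, ?_, ?_, ?_, ?_⟩
  · intro x hx hu
    obtain ⟨i, hi, rfl⟩ := (h.mem x).1 hx
    exact h1 i hi fun j hj e => h.inj _ _ hj hi (hu _ (h.mem' hj) e)
  · intro x hx hu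
    obtain ⟨i, hi, rfl⟩ := (h.mem x).1 hx
    exact h2 i hi fun j hj e => h.inj _ _ hj hi (hu _ (h.mem' hj) e)
  · intro x hx y hy hne e
    obtain ⟨i, hi, rfl⟩ := (h.mem x).1 hx
    obtain ⟨j, hj, rfl⟩ := (h.mem y).1 hy
    rcases lt_trichotomy i j with hij | rfl | hij
    · exact h3 i j hij hj e
    · exact absurd rfl hne
    · have := h3 j i hij hi e.symm; tauto
  · intro x hx y hy hne e
    obtain ⟨i, hi, rfl⟩ := (h.mem x).1 hx
    obtain ⟨j, hj, rfl⟩ := (h.mem y).1 hy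
    rcases lt_trichotomy i j with hij | rfl | hij
    · exact h4 i j hij hj e
    · exact absurd rfl hne
    · exact (h4 j i hij hi e.symm).symm

/-- in a path, the end arcs lack a partner -/
lemma Sq8.ends {Z : Finset (V × V)} {a : ℕ → V × V} {m p : ℕ} (h : Sq8 Z a m p) (hU : U8 Z)
    (hc : ¬ Cyc8 a m) (i : ℕ) (hi : i = 0 ∨ i = m - 1) :
    (∀ j, j < m → (a j).2 = (a i).2 → j = i) ∨ (∀ j, j < m → (a j).1 = (a i).1 → j = i) := by
  have hpos := h.pos
  by_contra hcon
  push Not at hcon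
  obtain ⟨⟨j, hj, ej, nj⟩, ⟨k, hk, ek, nk⟩⟩ := hcon
  have hjk : j ≠ k := by
    rintro rfl
    exact h.both hj (by omega) nj ek ej
  have key : ∀ j, j < m → j ≠ i → ((a j).2 = (a i).2 ∨ (a j).1 = (a i).1) →
      (i = 0 ∧ j = 1) ∨ (i = m - 1 ∧ j + 2 = m) := by
    intro j hj nj e
    rcases lt_or_gt_of_ne nj with hlt | hlt
    · rcases h.adj hU hlt (by omega) e with h1 | ⟨rfl, rfl, h3⟩
      · omega
      · exact absurd ⟨h3, e⟩ hc
    · rcases h.adj hU hlt (by omega) (e.imp Eq.symm Eq.symm) with h1 | ⟨rfl, rfl, h3⟩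
      · omega
      · exact absurd ⟨h3, e.imp Eq.symm Eq.symm⟩ hc
  have := key j hj nj (Or.inl ej)
  have := key k hk nk (Or.inr ek)
  omega

lemma Sq8.adm_path {Z : Finset (V × V)} {a : ℕ → V × V} {m p : ℕ} (h : Sq8 Z a m p) (hU : U8 Z)
    (hc : ¬ Cyc8 a m) {S : Finset (V × V)} (hSZ : S ⊆ Z) :
    Adm8 Z S ↔ a 0 ∈ S ∧ a (m - 1) ∈ S ∧ Link8 (fun i => a i ∈ S) m p := by
  have hpos := h.pos
  constructor
  · intro hS
    have key : ∀ i, (i = 0 ∨ i = m - 1) → a i ∈ S := by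
      intro i hi
      have him : i < m := by omega
      rcases h.ends hU hc i hi with h1 | h1
      · refine hS.2.1 _ (h.mem' him) ?_
        intro b hb e
        obtain ⟨j, hj, rfl⟩ := (h.mem b).1 hb
        rw [h1 j hj e]
      · refine hS.2.2.1 _ (h.mem' him) ?_
        intro b hb e
        obtain ⟨j, hj, rfl⟩ := (h.mem b).1 hb
        rw [h1 j hj e]
    exact ⟨key 0 (Or.inl rfl), key _ (Or.inr rfl), h.link hS⟩
  · rintro ⟨h0, hm, hL⟩
    refine h.adm_of hSZ ?_ ?_ ?_ ?_
    · intro i hi hu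
      by_cases hi0 : i = 0
      · subst hi0; exact h0
      by_cases him : i = m - 1
      · subst him; exact hm
      obtain ⟨k, rfl⟩ : ∃ k, i = k + 1 := ⟨i - 1, by omega⟩
      exfalso
      rcases Nat.mod_two_eq_zero_or_one (k + p) with hp | hp
      · have := hu (k + 1 + 1) (by omega) (h.hd (k + 1) (by omega) (by omega)).symm; omega
      · have := hu k (by omega) (h.hd k (by omega) (by omega)); omega
    · intro i hi hu
      by_cases hi0 : i = 0
      · subst hi0; exact h0
      by_cases him : i = m - 1
      · subst him; exact hm
      obtain ⟨k, rfl⟩ : ∃ k, i = k + 1 := ⟨i - 1, by omega⟩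
      exfalso
      rcases Nat.mod_two_eq_zero_or_one (k + p) with hp | hp
      · have := hu k (by omega) (h.tl k (by omega) (by omega)); omega
      · have := hu (k + 1 + 1) (by omega) (h.tl (k + 1) (by omega) (by omega)).symm; omega
    · intro i j hij hj e
      rcases h.adjH hU hij hj e with ⟨rfl, hp⟩ | ⟨rfl, rfl, h3⟩
      · exact (hL i hj).2 hp
      · exact absurd ⟨h3, Or.inl e⟩ hc
    · intro i j hij hj e
      rcases h.adjT hU hij hj e with ⟨rfl, hp⟩ | ⟨rfl, rfl, h3⟩
      · exact (hL i hj).1 hp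
      · exact absurd ⟨h3, Or.inr e⟩ hc

lemma Sq8.adm_cyc {Z : Finset (V × V)} {a : ℕ → V × V} {m : ℕ} (h : Sq8 Z a m 0) (hU : U8 Z)
    (h3 : 3 ≤ m) (hev : m % 2 = 0) (hc : (a 0).2 = (a (m - 1)).2) {S : Finset (V × V)}
    (hSZ : S ⊆ Z) :
    Adm8 Z S ↔ (a 0 ∈ S ↔ a (m - 1) ∉ S) ∧ Link8 (fun i => a i ∈ S) m 0 := by
  constructor
  · intro hS
    exact ⟨hS.2.2.2.1 _ (h.mem' (by omega)) _ (h.mem' (by omega))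
      (h.ne (by omega) (by omega) (by omega)) hc, h.link hS⟩
  · rintro ⟨h0, hL⟩
    refine h.adm_of hSZ ?_ ?_ ?_ ?_
    · intro i hi hu
      exfalso
      by_cases hi0 : i = 0
      · subst hi0
        have := hu (m - 1) (by omega) hc.symm; omega
      by_cases him : i = m - 1
      · subst him
        have := hu 0 (by omega) hc; omega
      obtain ⟨k, rfl⟩ : ∃ k, i = k + 1 := ⟨i - 1, by omega⟩
      rcases Nat.mod_two_eq_zero_or_one k with hp | hp
      · have := hu (k + 1 + 1) (by omega) (h.hd (k + 1) (by omega) (by omega)).symm; omega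
      · have := hu k (by omega) (h.hd k (by omega) (by omega)); omega
    · intro i hi hu
      exfalso
      rcases Nat.mod_two_eq_zero_or_one i with hp | hp
      · have := hu (i + 1) (by omega) (h.tl i (by omega) (by omega)).symm; omega
      · obtain ⟨k, rfl⟩ : ∃ k, i = k + 1 := ⟨i - 1, by omega⟩
        have := hu k (by omega) (h.tl k (by omega) (by omega)); omega
    · intro i j hij hj e
      rcases h.adjH hU hij hj e with ⟨rfl, hp⟩ | ⟨rfl, rfl, h3⟩
      · exact (hL i hj).2 hp
      · exact h0
    · intro i j hij hj e
      rcases h.adjT hU hij hj e with ⟨rfl, hp⟩ | ⟨rfl, rfl, h3⟩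
      · exact (hL i hj).1 hp
      · exact (h.both (by omega) (by omega) (by omega) e hc).elim

open Classical in
lemma Sq8.count {Z : Finset (V × V)} {a : ℕ → V × V} {m p : ℕ} (h : Sq8 Z a m p)
    (k : ℕ) (f : ℕ → ℕ → Prop)
    (hf : ∀ S, S ⊆ Z → (Adm8 Z S ↔ ∃ t, t < k ∧ ∀ i, i < m → (a i ∈ S ↔ f t i)))
    (hinj : ∀ t t', t < k → t' < k → (∀ i, i < m → (f t i ↔ f t' i)) → t = t') :
    (Z.powerset.filter (Adm8 Z)).card = k := by
  let F : ℕ → Finset (V × V) := fun t => ((Finset.range m).filter (f t)).image a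
  have hF : ∀ t i, i < m → (a i ∈ F t ↔ f t i) := by
    intro t i hi
    simp only [F, Finset.mem_image, Finset.mem_filter, Finset.mem_range]
    constructor
    · rintro ⟨j, ⟨hj, hfj⟩, e⟩
      rw [← h.inj _ _ hj hi e]; exact hfj
    · intro hfi; exact ⟨i, ⟨hi, hfi⟩, rfl⟩
  have hFZ : ∀ t, F t ⊆ Z := by
    intro t x hx
    simp only [F, Finset.mem_image, Finset.mem_filter, Finset.mem_range] at hx
    obtain ⟨j, ⟨hj, _⟩, rfl⟩ := hx
    exact h.mem' hj
  have : Z.powerset.filter (Adm8 Z) = (Finset.range k).image F := by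
    ext S
    rw [Finset.mem_filter, Finset.mem_powerset, Finset.mem_image]
    constructor
    · rintro ⟨hS, hA⟩
      obtain ⟨t, ht, hh⟩ := (hf S hS).1 hA
      refine ⟨t, Finset.mem_range.2 ht, ?_⟩
      ext x
      constructor
      · intro hx
        obtain ⟨i, hi, rfl⟩ := (h.mem x).1 (hFZ t hx)
        rw [hh i hi, ← hF t i hi]; exact hx
      · intro hx
        obtain ⟨i, hi, rfl⟩ := (h.mem x).1 (hS hx)
        rw [hF t i hi, ← hh i hi]; exact hx
    · rintro ⟨t, ht, rfl⟩
      exact ⟨hFZ t, (hf _ (hFZ t)).2 ⟨t, Finset.mem_range.1 ht, hF t⟩⟩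
  rw [this, Finset.card_image_of_injOn, Finset.card_range]
  intro t ht t' ht' e
  simp only [Finset.coe_range, Set.mem_Iio] at ht ht'
  refine hinj t t' ht ht' fun i hi => ?_
  rw [← hF t i hi, ← hF t' i hi]
  rw [e]

lemma bool_head8 (b : ℕ → Prop) (m : ℕ) (h0 : b 0) (hL : Link8 b m 1) :
    ∀ i, i < m → (b i ↔ i % 2 = 0) := by
  intro i
  induction i with
  | zero => intro _; simpa using h0
  | succ i ih =>
    intro hi
    have := ih (by omega)
    obtain ⟨h1, h2⟩ := hL i hi
    rcases Nat.mod_two_eq_zero_or_one i with hp | hp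
    · have h2 := h2 (by omega)
      have : b i := this.2 hp
      have : ¬ b (i + 1) := h2.1 this
      constructor
      · intro hh; exact absurd hh this
      · intro hh; omega
    · have h1 := h1 (by omega)
      have : ¬ b i := fun hh => by have := this.1 hh; omega
      constructor
      · intro hh; omega
      · intro hh; tauto

lemma bool_tail8 (b : ℕ → Prop) (m : ℕ) (h0 : ¬ b 0) (hL : Link8 b m 0) :
    ∀ i, i < m → (b i ↔ i % 2 = 1) := by
  intro i
  induction i with
  | zero => intro _; simpa using h0
  | succ i ih =>
    intro hi
    have := ih (by omega)
    obtain ⟨h1, h2⟩ := hL i hi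
    rcases Nat.mod_two_eq_zero_or_one i with hp | hp
    · have h1 := h1 (by omega)
      have : ¬ b i := fun hh => by have := this.1 hh; omega
      constructor
      · intro hh; omega
      · intro hh; tauto
    · have h2 := h2 (by omega)
      have : b i := this.2 hp
      have : ¬ b (i + 1) := h2.1 this
      constructor
      · intro hh; exact absurd hh this
      · intro hh; omega

lemma bool_cyc8 (b : ℕ → Prop) (m : ℕ) (hm : 3 ≤ m) (hev : m % 2 = 0) :
    ((b 0 ↔ ¬ b (m - 1)) ∧ Link8 b m 0) ↔ ∃ t, t < 2 ∧ ∀ i, i < m → (b i ↔ i % 2 = t) := by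
  constructor
  · rintro ⟨h0, hL⟩
    by_cases hb : b 0
    · refine ⟨0, by omega, ?_⟩
      have := bool_tail8 (fun i => b (m - 1 - i)) m (by simpa using h0.1 hb) (by
        intro i hi
        have := hL (m - 1 - (i + 1)) (by omega)
        have e : m - 1 - (i + 1) + 1 = m - 1 - i := by omega
        rw [e] at this
        constructor
        · intro hp; exact (this.1 (by omega)).symm
        · intro hp; have := this.2 (by omega); tauto)
      intro i hi
      have h := this (m - 1 - i) (by omega)
      have e : m - 1 - (m - 1 - i) = i := by omega
      simp only [e] at h
      rw [h]; omega
    · exact ⟨1, by omega, bool_tail8 b m hb hL⟩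
  · rintro ⟨t, ht, h⟩
    refine ⟨?_, ?_⟩
    · rw [h 0 (by omega), h (m - 1) (by omega)]; omega
    · intro i hi
      rw [h i (by omega), h (i + 1) hi]; omega

lemma bool_M8 (b : ℕ → Prop) (m : ℕ) (hm : 0 < m) (hev : m % 2 = 0) :
    (b 0 ∧ b (m - 1) ∧ Link8 b m 0) ↔ ∃ t, t < m / 2 ∧ ∀ i, i < m →
      (b i ↔ (i % 2 = 0 ∧ i ≤ 2 * t) ∨ (i % 2 = 1 ∧ 2 * t < i)) := by
  classical
  constructor
  · rintro ⟨h0, h1, hL⟩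
    let P : ℕ → Prop := fun t => b (2 * t)
    have hP0 : P 0 := h0
    let t := Nat.findGreatest P (m / 2 - 1)
    have ht1 : t ≤ m / 2 - 1 := Nat.findGreatest_le _
    have ht2 : b (2 * t) := Nat.findGreatest_spec (P := P) (Nat.zero_le _) hP0
    have ht3 : ∀ j, t < j → j < m / 2 → ¬ b (2 * j) := fun j hj hj' =>
      Nat.findGreatest_is_greatest (P := P) hj (by omega)
    have step : ∀ j, 2 * (j + 1) < m → b (2 * (j + 1)) → b (2 * j) ∧ ¬ b (2 * j + 1) := by
      intro j hj hb
      have a1 := (hL (2 * j) (by omega)).1 (by omega)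
      have a2 := (hL (2 * j + 1) (by omega)).2 (by omega)
      have e : 2 * j + 1 + 1 = 2 * (j + 1) := by ring
      rw [e] at a2
      tauto
    have ht4 : ∀ d j, j + d = t → b (2 * j) := by
      intro d
      induction d with
      | zero => intro j hj; have : j = t := by omega
                rw [this]; exact ht2
      | succ d ih =>
        intro j hj
        exact (step j (by omega) (ih (j + 1) (by omega))).1
    have ht5 : ∀ j, j ≤ t → b (2 * j) := fun j hj => ht4 (t - j) j (by omega)
    refine ⟨t, by omega, ?_⟩
    intro i hi
    rcases Nat.mod_two_eq_zero_or_one i with hp | hp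
    · obtain ⟨j, rfl⟩ : ∃ j, i = 2 * j := ⟨i / 2, by omega⟩
      by_cases hj : j ≤ t
      · have := ht5 j hj
        constructor
        · intro _; left; omega
        · intro _; exact this
      · have := ht3 j (by omega) (by omega)
        constructor
        · intro hh; exact absurd hh this
        · intro _; omega
    · obtain ⟨j, rfl⟩ : ∃ j, i = 2 * j + 1 := ⟨i / 2, by omega⟩
      by_cases hj : j < t
      · have := (step j (by omega) (ht5 (j + 1) (by omega))).2
        constructor
        · intro hh; exact absurd hh this
        · intro _; omega
      · have : b (2 * j + 1) := by
          by_cases hl : 2 * j + 2 < m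
          · have a2 := (hL (2 * j + 1) (by omega)).2 (by omega)
            rw [a2]
            exact ht3 (j + 1) (by omega) (by omega)
          · have : 2 * j + 1 = m - 1 := by omega
            rw [this]; exact h1
        constructor
        · intro _; right; omega
        · intro _; exact this
  · rintro ⟨t, ht, h⟩
    refine ⟨?_, ?_, ?_⟩
    · rw [h 0 (by omega)]; omega
    · rw [h (m - 1) (by omega)]; omega
    · intro i hi
      rw [h i (by omega), h (i + 1) hi]; omega

open Classical in
lemma Sq8.count_M {Z : Finset (V × V)} {a : ℕ → V × V} {m : ℕ} (h : Sq8 Z a m 0) (hU : U8 Z)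
    (hc : ¬ Cyc8 a m) (hev : m % 2 = 0) : (Z.powerset.filter (Adm8 Z)).card = m / 2 := by
  have hpos := h.pos
  refine h.count (m / 2) (fun t i => (i % 2 = 0 ∧ i ≤ 2 * t) ∨ (i % 2 = 1 ∧ 2 * t < i)) ?_ ?_
  · intro S hS
    rw [h.adm_path hU hc hS]
    exact bool_M8 (fun i => a i ∈ S) m hpos hev
  · intro t t' ht ht' hh
    have h1 := hh (2 * t) (by omega)
    have h2 := hh (2 * t') (by omega)
    omega

open Classical in
lemma Sq8.count_N {Z : Finset (V × V)} {a : ℕ → V × V} {m : ℕ} (h : Sq8 Z a m 1) (hU : U8 Z)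
    (hc : ¬ Cyc8 a m) (hev : m % 2 = 1) : (Z.powerset.filter (Adm8 Z)).card = 1 := by
  have hpos := h.pos
  refine h.count 1 (fun _ i => i % 2 = 0) ?_ ?_
  · intro S hS
    rw [h.adm_path hU hc hS]
    constructor
    · rintro ⟨h0, h1, hL⟩
      exact ⟨0, by omega, bool_head8 (fun i => a i ∈ S) m h0 hL⟩
    · rintro ⟨t, ht, hh⟩
      refine ⟨(hh 0 hpos).2 rfl, (hh _ (by omega)).2 (by omega), ?_⟩
      intro i hi
      simp only
      rw [hh i (by omega), hh (i + 1) hi]; omega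
  · intro t t' ht ht' hh
    omega

lemma Sq8.no_W {Z : Finset (V × V)} {a : ℕ → V × V} {m : ℕ} (h : Sq8 Z a m 1) (hU : U8 Z)
    (hc : ¬ Cyc8 a m) (hev : m % 2 = 0) (hex : ∃ S, Adm8 Z S) : False := by
  have hpos := h.pos
  obtain ⟨S, hS⟩ := hex
  obtain ⟨h0, h1, hL⟩ := (h.adm_path hU hc hS.1).1 hS
  have := (bool_head8 (fun i => a i ∈ S) m h0 hL (m - 1) (by omega)).1 h1
  omega

open Classical in
lemma Sq8.count_C {Z : Finset (V × V)} {a : ℕ → V × V} {m : ℕ} (h : Sq8 Z a m 0) (hU : U8 Z)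
    (h3 : 3 ≤ m) (hev : m % 2 = 0) (hc : (a 0).2 = (a (m - 1)).2) :
    (Z.powerset.filter (Adm8 Z)).card = 2 := by
  refine h.count 2 (fun t i => i % 2 = t) ?_ ?_
  · intro S hS
    rw [h.adm_cyc hU h3 hev hc hS]
    exact bool_cyc8 (fun i => a i ∈ S) m h3 hev
  · intro t t' ht ht' hh
    have h1 := hh 0 (by omega)
    have h2 := hh 1 (by omega)
    omega

lemma Sq8.crown {Z : Finset (V × V)} {a : ℕ → V × V} {m : ℕ} (h : Sq8 Z a m 0)
    (h3 : 3 ≤ m) (hev : m % 2 = 0) (hc : (a 0).2 = (a (m - 1)).2) : CrownForm Z := by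
  refine ⟨m, fun k => if k % 2 = 1 then (a (k - 1)).1 else if k = 0 then (a 0).2
    else (a (k - 1)).2, by omega, hev, ?_, h.card, ?_⟩
  · have : m ≠ 0 := by omega
    simp [hev, this, hc]
  · have key : ∀ i, i < m → mArc (fun k => if k % 2 = 1 then (a (k - 1)).1 else
        if k = 0 then (a 0).2 else (a (k - 1)).2) (i + 1) = a i := by
      intro i hi
      unfold mArc
      rcases Nat.mod_two_eq_zero_or_one i with hp | hp
      · have e1 : (i + 1) % 2 = 1 := by omega
        by_cases h0 : i = 0
        · subst h0; simp
        · obtain ⟨k, rfl⟩ : ∃ k, i = k + 1 := ⟨i - 1, by omega⟩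
          have := h.hd k hi (by omega)
          simp [e1, hp, this]
      · have e1 : (i + 1) % 2 = 0 := by omega
        obtain ⟨k, rfl⟩ : ∃ k, i = k + 1 := ⟨i - 1, by omega⟩
        have := h.tl k hi (by omega)
        simp [e1, hp, this]
    ext x
    rw [h.mem, Finset.mem_image]
    constructor
    · rintro ⟨i, hi, rfl⟩
      exact ⟨i + 1, by simp; omega, key i hi⟩
    · rintro ⟨k, hk, rfl⟩
      rw [Finset.mem_Icc] at hk
      obtain ⟨i, rfl⟩ : ∃ i, k = i + 1 := ⟨k - 1, by omega⟩
      exact ⟨i, by omega, (key i (by omega)).symm⟩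

lemma crown_partner8 {Z : Finset (V × V)} (h : CrownForm Z) (x : V × V) (hx : x ∈ Z) :
    (∃ y ∈ Z, y ≠ x ∧ y.2 = x.2) ∧ (∃ y ∈ Z, y ≠ x ∧ y.1 = x.1) := by
  obtain ⟨m, v, hm, hev, hcl, hcard, hZ⟩ := h
  have hinj : Set.InjOn (mArc v) (Finset.Icc 1 m) := by
    apply Finset.card_image_iff.1
    rw [← hZ, hcard]; simp
  have hmem : ∀ k, 1 ≤ k → k ≤ m → mArc v k ∈ Z := by
    intro k h1 h2
    rw [hZ]; exact Finset.mem_image_of_mem _ (Finset.mem_Icc.2 ⟨h1, h2⟩)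
  have hne : ∀ k l, 1 ≤ k → k ≤ m → 1 ≤ l → l ≤ m → k ≠ l → mArc v k ≠ mArc v l := by
    intro k l h1 h2 h3 h4 hkl e
    exact hkl (hinj (by simp; omega) (by simp; omega) e)
  have hodd : ∀ j, mArc v (2 * j + 1) = (v (2 * j + 1), v (2 * j)) := by
    intro j
    have : (2 * j + 1) % 2 = 1 := by omega
    simp [mArc]
  have heven : ∀ j, mArc v (2 * j + 2) = (v (2 * j + 1), v (2 * j + 2)) := by
    intro j
    simp [mArc]
  rw [hZ, Finset.mem_image] at hx
  obtain ⟨k, hk, rfl⟩ := hx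
  rw [Finset.mem_Icc] at hk
  rcases Nat.mod_two_eq_zero_or_one k with hp | hp
  · obtain ⟨j, rfl⟩ : ∃ j, k = 2 * j + 2 := ⟨k / 2 - 1, by omega⟩
    constructor
    · by_cases hl : 2 * j + 2 = m
      · refine ⟨mArc v (2 * 0 + 1), hmem _ (by omega) (by omega),
          hne _ _ (by omega) (by omega) (by omega) (by omega) (by omega), ?_⟩
        rw [hodd, heven, hl]; exact hcl.symm
      · refine ⟨mArc v (2 * (j + 1) + 1), hmem _ (by omega) (by omega),
          hne _ _ (by omega) (by omega) (by omega) (by omega) (by omega), ?_⟩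
        rw [hodd, heven]; rfl
    · refine ⟨mArc v (2 * j + 1), hmem _ (by omega) (by omega),
          hne _ _ (by omega) (by omega) (by omega) (by omega) (by omega), ?_⟩
      rw [hodd, heven]
  · obtain ⟨j, rfl⟩ : ∃ j, k = 2 * j + 1 := ⟨k / 2, by omega⟩
    constructor
    · by_cases hl : j = 0
      · subst hl
        obtain ⟨q, hq⟩ : ∃ q, m = 2 * q + 2 := ⟨m / 2 - 1, by omega⟩
        refine ⟨mArc v (2 * q + 2), hmem _ (by omega) (by omega),
          hne _ _ (by omega) (by omega) (by omega) (by omega) (by omega), ?_⟩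
        rw [hodd, heven, ← hq]; exact hcl
      · obtain ⟨q, rfl⟩ : ∃ q, j = q + 1 := ⟨j - 1, by omega⟩
        refine ⟨mArc v (2 * q + 2), hmem _ (by omega) (by omega),
          hne _ _ (by omega) (by omega) (by omega) (by omega) (by omega), ?_⟩
        rw [hodd, heven]; rfl
    · refine ⟨mArc v (2 * j + 2), hmem _ (by omega) (by omega),
          hne _ _ (by omega) (by omega) (by omega) (by omega) (by omega), ?_⟩
      rw [hodd, heven]

lemma Sq8.not_crown {Z : Finset (V × V)} {a : ℕ → V × V} {m p : ℕ} (h : Sq8 Z a m p) (hU : U8 Z)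
    (hc : ¬ Cyc8 a m) : ¬ CrownForm Z := by
  intro hC
  have hpos := h.pos
  obtain ⟨⟨y, hy, ny, ey⟩, ⟨z, hz, nz, ez⟩⟩ := crown_partner8 hC (a 0) (h.mem' hpos)
  obtain ⟨j, hj, rfl⟩ := (h.mem y).1 hy
  obtain ⟨k, hk, rfl⟩ := (h.mem z).1 hz
  rcases h.ends hU hc 0 (Or.inl rfl) with h1 | h1
  · exact ny (by rw [h1 j hj ey])
  · exact nz (by rw [h1 k hk ez])

lemma Sq8.rev {Z : Finset (V × V)} {a : ℕ → V × V} {m : ℕ} (h : Sq8 Z a m 0)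
    (hm : m % 2 = 1) : Sq8 Z (fun i => a (m - 1 - i)) m 1 := by
  have hpos := h.pos
  refine ⟨hpos, ?_, ?_, ?_, ?_⟩
  · intro x
    rw [h.mem]
    constructor
    · rintro ⟨i, hi, rfl⟩
      refine ⟨m - 1 - i, by omega, ?_⟩
      have : m - 1 - (m - 1 - i) = i := by omega
      simp only [this]
    · rintro ⟨i, hi, rfl⟩
      exact ⟨m - 1 - i, by omega, rfl⟩
  · intro i j hi hj e
    have := h.inj _ _ (by omega) (by omega) e
    omega
  · intro i hi hp
    have := h.tl (m - 1 - (i + 1)) (by omega) (by omega)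
    have e : m - 1 - (i + 1) + 1 = m - 1 - i := by omega
    rw [e] at this
    exact this.symm
  · intro i hi hp
    have := h.hd (m - 1 - (i + 1)) (by omega) (by omega)
    have e : m - 1 - (i + 1) + 1 = m - 1 - i := by omega
    rw [e] at this
    exact this.symm

lemma Sq8.rot {Z : Finset (V × V)} {a : ℕ → V × V} {m : ℕ} (h : Sq8 Z a m 1)
    (h3 : 3 ≤ m) (hm : m % 2 = 0) (hc : (a 0).1 = (a (m - 1)).1) :
    Sq8 Z (fun i => if i + 1 = m then a 0 else a (i + 1)) m 0 := by
  refine ⟨by omega, ?_, ?_, ?_, ?_⟩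
  · intro x
    rw [h.mem]
    constructor
    · rintro ⟨i, hi, rfl⟩
      by_cases hi0 : i = 0
      · subst hi0
        refine ⟨m - 1, by omega, ?_⟩
        rw [if_pos (by omega)]
      · refine ⟨i - 1, by omega, ?_⟩
        rw [if_neg (by omega)]
        congr 1; omega
    · rintro ⟨i, hi, rfl⟩
      by_cases hi0 : i + 1 = m
      · rw [if_pos hi0]; exact ⟨0, by omega, rfl⟩
      · rw [if_neg hi0]; exact ⟨i + 1, by omega, rfl⟩
  · intro i j hi hj e
    split_ifs at e with h1 h2 h2
    · omega
    · have := h.inj _ _ (by omega) (by omega) e; omega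
    · have := h.inj _ _ (by omega) (by omega) e; omega
    · have := h.inj _ _ (by omega) (by omega) e; omega
  · intro i hi hp
    rw [if_neg (by omega)]
    by_cases hl : i + 1 + 1 = m
    · rw [if_pos hl, hc]
      have : i + 1 = m - 1 := by omega
      rw [this]
    · rw [if_neg hl]
      exact h.tl (i + 1) (by omega) (by omega)
  · intro i hi hp
    rw [if_neg (by omega), if_neg (by omega)]
    exact h.hd (i + 1) (by omega) (by omega)

lemma exists_Sq8 {Z : Finset (V × V)} (hU : U8 Z) (l : List (V × V)) (hl0 : l ≠ [])
    (hnd : l.Nodup) (hlZ : l.toFinset = Z) (hch : l.IsChain fun a b => a.2 = b.2 ∨ a.1 = b.1) :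
    ∃ a m p, Sq8 Z a m p ∧ p < 2 := by
  let x0 := l.head hl0
  let a : ℕ → V × V := fun i => l.getD i x0
  have ha : ∀ i (hi : i < l.length), a i = l[i] := fun i hi => by simp [a, hi]
  have hmem : ∀ x, x ∈ Z ↔ ∃ i, i < l.length ∧ a i = x := by
    intro x
    rw [← hlZ, List.mem_toFinset, List.mem_iff_getElem]
    constructor
    · rintro ⟨i, hi, rfl⟩; exact ⟨i, hi, ha i hi⟩
    · rintro ⟨i, hi, rfl⟩; exact ⟨i, hi, (ha i hi).symm⟩
  have hinj : ∀ i j, i < l.length → j < l.length → a i = a j → i = j := by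
    intro i j hi hj e
    rw [ha i hi, ha j hj] at e
    exact (hnd.getElem_inj_iff).1 e
  have hch' : ∀ i, i + 1 < l.length → (a i).2 = (a (i + 1)).2 ∨ (a i).1 = (a (i + 1)).1 := by
    intro i hi
    rw [ha i (by omega), ha (i + 1) hi]
    exact List.isChain_iff_getElem.1 hch i hi
  have hm' : ∀ i, i < l.length → a i ∈ Z := fun i hi => (hmem _).2 ⟨i, hi, rfl⟩
  have alt : ∀ i, i + 2 < l.length →
      ((a i).2 = (a (i + 1)).2 → (a (i + 1)).1 = (a (i + 2)).1) ∧
      ((a i).1 = (a (i + 1)).1 → (a (i + 1)).2 = (a (i + 2)).2) := by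
    intro i hi
    have n1 : a (i + 1) ≠ a i := fun e => by
      have := hinj _ _ (by omega) (by omega) e; omega
    have n2 : a (i + 1) ≠ a (i + 2) := fun e => by
      have := hinj _ _ (by omega) (by omega) e; omega
    have n3 : a i ≠ a (i + 2) := fun e => by
      have := hinj _ _ (by omega) (by omega) e; omega
    constructor
    · intro e
      rcases hch' (i + 1) hi with e' | e'
      · exact absurd (hU.1 _ (hm' (i + 1) (by omega)) _ (hm' i (by omega)) _
          (hm' (i + 2) (by omega)) n1 n2 e.symm e') n3
      · exact e'
    · intro e
      rcases hch' (i + 1) hi with e' | e'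
      · exact e'
      · exact absurd (hU.2 _ (hm' (i + 1) (by omega)) _ (hm' i (by omega)) _
          (hm' (i + 2) (by omega)) n1 n2 e.symm e') n3
  have main : ∀ p, (1 < l.length → (p % 2 = 0 → (a 0).1 = (a 1).1) ∧
      (p % 2 = 1 → (a 0).2 = (a 1).2)) → Sq8 Z a l.length p := by
    intro p h0
    have key : ∀ i, i + 1 < l.length → ((i + p) % 2 = 0 → (a i).1 = (a (i + 1)).1) ∧
        ((i + p) % 2 = 1 → (a i).2 = (a (i + 1)).2) := by
      intro i
      induction i with
      | zero => intro hi; simpa using h0 hi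
      | succ i ih =>
        intro hi
        have ih := ih (by omega)
        have := alt i hi
        exact ⟨fun hp => this.1 (ih.2 (by omega)), fun hp => this.2 (ih.1 (by omega))⟩
    exact ⟨List.length_pos_iff.2 hl0, hmem, hinj, fun i hi => (key i hi).1,
      fun i hi => (key i hi).2⟩
  by_cases h : (a 0).1 = (a 1).1
  · exact ⟨a, l.length, 0, main 0 (fun _ => ⟨fun _ => h, fun h => by omega⟩), by omega⟩
  · refine ⟨a, l.length, 1, main 1 (fun hl => ⟨fun h => by omega, fun _ => ?_⟩), by omega⟩
    rcases hch' 0 hl with e | e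
    · exact e
    · exact absurd e h

open Classical in
lemma count_local8 {Z : Finset (V × V)} (hU : U8 Z) (l : List (V × V)) (hl0 : l ≠ [])
    (hnd : l.Nodup) (hlZ : l.toFinset = Z) (hch : l.IsChain fun a b => a.2 = b.2 ∨ a.1 = b.1)
    (hex : ∃ S, Adm8 Z S) : (Z.powerset.filter (Adm8 Z)).card = trailCount Z := by
  obtain ⟨a, m, p, h, hp⟩ := exists_Sq8 hU l hl0 hnd hlZ hch
  have hcard := h.card
  have hpos := h.pos
  by_cases hc : Cyc8 a m
  · obtain ⟨h3, he⟩ := hc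
    have fin : ∀ a : ℕ → V × V, Sq8 Z a m 0 → m % 2 = 0 → (a 0).2 = (a (m - 1)).2 →
        (Z.powerset.filter (Adm8 Z)).card = trailCount Z := by
      intro a h hev hc
      rw [h.count_C hU h3 hev hc]
      unfold trailCount
      rw [if_pos (h.crown h3 hev hc)]
    have hp' : p = 0 ∨ p = 1 := by omega
    have em : m - 2 + 1 = m - 1 := by omega
    rcases hp' with rfl | rfl
    · have e0 := h.tl 0 (by omega) (by omega)
      have hc : (a 0).2 = (a (m - 1)).2 := by
        rcases he with he | he
        · exact he
        · have := h.ut hU (by omega) (by omega) (by omega) (by omega) (by omega) e0 he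
          omega
      refine fin a h ?_ hc
      by_contra hodd
      have := h.hd (m - 2) (by omega) (by omega)
      rw [em] at this
      have := h.uh hU (i := m - 1) (j := m - 2) (k := 0) (by omega) (by omega) (by omega)
        (by omega) (by omega) this.symm hc.symm
      omega
    · have e0 := h.hd 0 (by omega) (by omega)
      have hc : (a 0).1 = (a (m - 1)).1 := by
        rcases he with he | he
        · have := h.uh hU (by omega) (by omega) (by omega) (by omega) (by omega) e0 he
          omega
        · exact he
      have hev : m % 2 = 0 := by
        by_contra hodd
        have := h.tl (m - 2) (by omega) (by omega)
        rw [em] at this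
        have := h.ut hU (i := m - 1) (j := m - 2) (k := 0) (by omega) (by omega) (by omega)
          (by omega) (by omega) this.symm hc.symm
        omega
      refine fin _ (h.rot h3 hev hc) hev ?_
      rw [if_neg (by omega), if_pos (by omega)]
      exact e0.symm
  · have hnc := h.not_crown hU hc
    unfold trailCount
    rw [if_neg hnc, hcard]
    have hp' : p = 0 ∨ p = 1 := by omega
    rcases Nat.mod_two_eq_zero_or_one m with hm | hm
    · rw [if_pos hm]
      rcases hp' with rfl | rfl
      · exact h.count_M hU hc hm
      · exact (h.no_W hU hc hm hex).elim
    · rw [if_neg (by omega)]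
      rcases hp' with rfl | rfl
      · refine (h.rev hm).count_N hU ?_ hm
        rintro ⟨h3, he⟩
        apply hc
        refine ⟨h3, ?_⟩
        simp only [Nat.sub_zero, Nat.sub_self] at he
        exact he.imp Eq.symm Eq.symm
      · exact h.count_N hU hc hm

end

/-- For a tree-based rooted binary phylogenetic `X`-network `N` with
maximal zig-zag trail decomposition `Z₁, …, Z_d`, the number of support trees of `N`
equals `∏ᵢ cᵢ`, where `cᵢ = 2` if `Zᵢ` is a crown, `cᵢ = |A(Zᵢ)|/2` if `Zᵢ` is an
M-fence, and `cᵢ = 1` if `Zᵢ` is an N-fence. -/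
theorem stmt8 {V : Type*} [DecidableEq V] (N : Dgraph V) (X : Finset V)
    (hN : Dgraph.IsRBPN N X) (hTB : Dgraph.IsTreeBased N X)
    (ZT : Finset (Finset (V × V)))
    (hZT : ∀ Z : Finset (V × V), Z ∈ ZT ↔ Dgraph.IsMaxZigzag N Z) :
    {τ : Dgraph V | Dgraph.IsSupportTree N X τ}.ncard = ∏ Z ∈ ZT, trailCount Z := by
  classical
  have hU : U8 N.arcs := uniq8 N X hN
  have hP := part8 N hU ZT hZT
  rw [ncard8 N X hN, count_prod8 hP]
  obtain ⟨τ, hτ⟩ := hTB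
  have hA := (adm_local8 hP τ.arcs).1 ((support_iff8 N X hN τ).1 hτ).2
  refine Finset.prod_congr rfl fun Z hZ => ?_
  obtain ⟨⟨hsub, l, hl0, hnd, hlZ, hch⟩, hmax⟩ := (hZT Z).1 hZ
  have hUZ : U8 Z := ⟨fun a ha b hb c hc => hU.1 a (hsub ha) b (hsub hb) c (hsub hc),
    fun a ha b hb c hc => hU.2 a (hsub ha) b (hsub hb) c (hsub hc)⟩
  convert count_local8 hUZ l hl0 hnd hlZ hch ⟨_, hA.2 Z hZ⟩
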